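/- Leray's formula: let L1, L2, L3 be Lagrangian subspaces of a real symplectic vector space (E, ω), and let γ12, γ23, γ31 be continuous paths of Lagrangian subspaces on [0,1] with γ12(0) = L1, γ12(1) = L2, γ23(0) = L2, γ23(1) = L3, γ31(0) = L3, γ31(1) = L1. If the concatenated loop γ12·γ23·γ31 based at L1 is null-homotopic (homotopic with fixed base point, through loops of Lagrangian subspaces, to the constant loop at L1), then [γ12 : const_{L2}] + [γ23 : const_{L3}] + [γ31 : const_{L1}] = (1/2) s(L1, L2, L3), where const_M denotes the constant path at M. -/

import Mathlib

open LinearMap (BilinForm)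

variable {E : Type*} [NormedAddCommGroup E] [NormedSpace ℝ E]

/-- A subspace is Lagrangian iff it equals its symplectic orthogonal. -/
def IsLagrangian (ω : BilinForm ℝ E) (L : Submodule ℝ E) : Prop :=
  LinearMap.BilinForm.orthogonal ω L = L

/-- Maximal dimension of a subspace on which the function `Q` is positive away from `0`. -/
noncomputable def posIndex {V : Type*} [AddCommGroup V] [Module ℝ V] (Q : V → ℝ) : ℕ :=
  sSup {d : ℕ | ∃ W : Submodule ℝ V, Module.finrank ℝ W = d ∧ ∀ x ∈ W, x ≠ 0 → 0 < Q x}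

/-- The quadratic form `Q(L1,L2,L3)` of a triplet of subspaces,
`Q(x1,x2,x3) = ω(x1,x2) + ω(x2,x3) + ω(x3,x1)`. -/
def tripleQ (ω : BilinForm ℝ E) (L1 L2 L3 : Submodule ℝ E) (v : L1 × L2 × L3) : ℝ :=
  ω v.1 v.2.1 + ω v.2.1 v.2.2 + ω v.2.2 v.1

/-- The signature `s(L1,L2,L3)` of a triplet of subspaces: the signature (number of positive
squares minus number of negative squares in a diagonalization) of `Q(L1,L2,L3)`. -/
noncomputable def tripleSig (ω : BilinForm ℝ E) (L1 L2 L3 : Submodule ℝ E) : ℤ :=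
  (posIndex (tripleQ ω L1 L2 L3) : ℤ) - (posIndex (fun v => - tripleQ ω L1 L2 L3 v) : ℤ)

/-- A continuous path of Lagrangian subspaces of `(E, ω)` on the interval `[a,b]`:  a family
`(L t)` of Lagrangian subspaces such that every `t0 ∈ [a,b]` has a neighbourhood `U` in `[a,b]`
on which there is a continuous family of idempotent linear maps of `E` with range `L t`. -/
structure IsLagrangianPath (ω : BilinForm ℝ E) (a b : ℝ) (L : ℝ → Submodule ℝ E) : Prop where
  lag : ∀ t ∈ Set.Icc a b, IsLagrangian ω (L t)
  locTriv : ∀ t0 ∈ Set.Icc a b, ∃ U ∈ nhdsWithin t0 (Set.Icc a b), U ⊆ Set.Icc a b ∧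
    ∃ P : ℝ → E →L[ℝ] E, ContinuousOn P U ∧
      ∀ t ∈ U, (P t).comp (P t) = P t ∧ LinearMap.range (P t : E →ₗ[ℝ] E) = L t

/-- A jointly continuous two-parameter family `(L s t)`, `s ∈ [0,1]`, `t ∈ [a,b]`, of Lagrangian
subspaces (a homotopy of paths of Lagrangian subspaces). -/
structure IsLagrangianHomotopy (ω : BilinForm ℝ E) (a b : ℝ)
    (L : ℝ → ℝ → Submodule ℝ E) : Prop where
  lag : ∀ s ∈ Set.Icc (0:ℝ) 1, ∀ t ∈ Set.Icc a b, IsLagrangian ω (L s t)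
  locTriv : ∀ p ∈ Set.Icc (0:ℝ) 1 ×ˢ Set.Icc a b,
    ∃ U ∈ nhdsWithin p (Set.Icc (0:ℝ) 1 ×ˢ Set.Icc a b),
      U ⊆ Set.Icc (0:ℝ) 1 ×ˢ Set.Icc a b ∧
      ∃ P : ℝ × ℝ → E →L[ℝ] E, ContinuousOn P U ∧
        ∀ q ∈ U, (P q).comp (P q) = P q ∧ LinearMap.range (P q : E →ₗ[ℝ] E) = L q.1 q.2

/-- Admissible data for a pair of paths of Lagrangian subspaces on `[a,b]`:  a partition
`a = t_0 ≤ t_1 ≤ … ≤ t_k = b` together with Lagrangian subspaces `M_1, …, M_k` such that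
`M_ν ∩ L_i(t) = 0` for all `t ∈ [t_{ν-1}, t_ν]`, `i = 1,2`.  (Here `M (ν+1)` plays the role
of `M_{ν+1}` for `0 ≤ ν < k`.) -/
structure AdmissibleData (ω : BilinForm ℝ E) (a b : ℝ) (L1 L2 : ℝ → Submodule ℝ E) where
  k : ℕ
  kpos : 0 < k
  t : ℕ → ℝ
  M : ℕ → Submodule ℝ E
  ht0 : t 0 = a
  htk : t k = b
  hmono : ∀ ν < k, t ν ≤ t (ν + 1)
  hlag : ∀ ν < k, IsLagrangian ω (M (ν + 1))
  htrans1 : ∀ ν < k, ∀ s ∈ Set.Icc (t ν) (t (ν + 1)), M (ν + 1) ⊓ L1 s = ⊥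
  htrans2 : ∀ ν < k, ∀ s ∈ Set.Icc (t ν) (t (ν + 1)), M (ν + 1) ⊓ L2 s = ⊥

/-- The expression `(1/2) Σ_ν ( s(L1(t_{ν-1}), L2(t_{ν-1}), M_ν) − s(L1(t_ν), L2(t_ν), M_ν) )`
computed from admissible data; by well-definedness this is the intersection number `[L1 : L2]`. -/
noncomputable def dataSum {ω : BilinForm ℝ E} {a b : ℝ} {L1 L2 : ℝ → Submodule ℝ E}
    (D : AdmissibleData ω a b L1 L2) : ℝ :=
  (1 / 2 : ℝ) * ∑ ν ∈ Finset.range D.k,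
    ((tripleSig ω (L1 (D.t ν)) (L2 (D.t ν)) (D.M (ν + 1)) : ℝ)
      - (tripleSig ω (L1 (D.t (ν + 1))) (L2 (D.t (ν + 1))) (D.M (ν + 1)) : ℝ))

/-- A continuous path of symplectic automorphisms of `(E, ω)` on `[a,b]`. -/
structure IsSymplecticPath (ω : BilinForm ℝ E) (a b : ℝ) (A : ℝ → E →L[ℝ] E) : Prop where
  bij : ∀ t ∈ Set.Icc a b, Function.Bijective (A t)
  symp : ∀ t ∈ Set.Icc a b, ∀ x y, ω (A t x) (A t y) = ω x y
  cont : ContinuousOn A (Set.Icc a b)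

/-- The symplectic form of `E × E⁻`: `((x1,x2),(y1,y2)) ↦ ω(x1,y1) − ω(x2,y2)`. -/
noncomputable def prodNegForm (ω : BilinForm ℝ E) : BilinForm ℝ (E × E) :=
  LinearMap.mk₂ ℝ (fun x y => ω x.1 y.1 - ω x.2 y.2)
    (fun x x' y => by simp only [Prod.fst_add, Prod.snd_add, map_add, LinearMap.add_apply]; ring)
    (fun c x y => by
      simp only [Prod.smul_fst, Prod.smul_snd, map_smul, LinearMap.smul_apply, smul_eq_mul]; ring)
    (fun x y y' => by simp only [Prod.fst_add, Prod.snd_add, map_add]; ring)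
    (fun c x y => by simp only [Prod.smul_fst, Prod.smul_snd, map_smul, smul_eq_mul]; ring)

/-- The graph `Γ_A = {(A x, x)}` of an endomorphism, as a subspace of `E × E`. -/
def graphSub (A : E →L[ℝ] E) : Submodule ℝ (E × E) :=
  LinearMap.range ((A : E →ₗ[ℝ] E).prod LinearMap.id)

/-- The diagonal `Δ = {(x, x)}` in `E × E`. -/
def diagSub : Submodule ℝ (E × E) :=
  LinearMap.range ((LinearMap.id : E →ₗ[ℝ] E).prod LinearMap.id)

section Signature

variable {V V' : Type*} [AddCommGroup V] [Module ℝ V] [AddCommGroup V'] [Module ℝ V']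

/-- The signature of a real quadratic form. -/
noncomputable def QuadraticForm.signature (Q : QuadraticForm ℝ V) : ℤ :=
  (sigPos Q : ℤ) - (sigNeg Q : ℤ)

lemma posIndex_eq_sigPos [FiniteDimensional ℝ V] (Q : QuadraticForm ℝ V) :
    posIndex Q = sigPos Q := by
  rw [← (sigPos_isGreatest Q).csSup_eq, posIndex]
  congr! 5 with d W
  refine and_congr_right fun _ => ⟨fun h x hx => h x x.2 (by simpa using hx), fun h x hx hx0 =>
    h ⟨x, hx⟩ (by simpa using hx0)⟩

lemma QuadraticForm.signature_eq_of_equiv {Q : QuadraticForm ℝ V} {Q' : QuadraticForm ℝ V'}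
    (e : V ≃ₗ[ℝ] V') (h : ∀ v, Q' (e v) = Q v) : Q.signature = Q'.signature := by
  have : QuadraticMap.Equivalent Q Q' := ⟨⟨e, h⟩⟩
  rw [signature, signature, this.sigPos_eq, this.sigNeg_eq]

lemma QuadraticForm.signature_neg (Q : QuadraticForm ℝ V) : (-Q).signature = -Q.signature := by
  simp [signature]

lemma QuadraticForm.finrank_le_sigPos_of_linearMap [FiniteDimensional ℝ V'] {Q : QuadraticForm ℝ V'}
    (T : V →ₗ[ℝ] V') (h : ∀ v, v ≠ 0 → 0 < Q (T v)) : Module.finrank ℝ V ≤ sigPos Q := by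
  have hinj : Function.Injective T := by
    rw [← LinearMap.ker_eq_bot, LinearMap.ker_eq_bot']
    intro v hv
    by_contra h0
    simpa [hv] using h v h0
  rw [← LinearMap.finrank_range_of_inj hinj]
  refine le_sigPos_of_posDef Q ?_
  rintro ⟨_, v, rfl⟩ h0
  exact h v fun hv => h0 (by simp [hv])

lemma QuadraticForm.sigPos_add_le_sigPos_prod [FiniteDimensional ℝ V] [FiniteDimensional ℝ V']
    (Q : QuadraticForm ℝ V) (Q' : QuadraticForm ℝ V') :
    sigPos Q + sigPos Q' ≤ sigPos (QuadraticMap.prod Q Q') := by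
  obtain ⟨W, hW, hQ⟩ := exists_finrank_eq_sigPos_and_posDef Q
  obtain ⟨W', hW', hQ'⟩ := exists_finrank_eq_sigPos_and_posDef Q'
  rw [← hW, ← hW', ← Module.finrank_prod]
  refine finrank_le_sigPos_of_linearMap (W.subtype.prodMap W'.subtype) ?_
  rintro ⟨w, w'⟩ h
  have hw : 0 ≤ Q w := hQ.nonneg w
  have hw' : 0 ≤ Q' w' := hQ'.nonneg w'
  simp only [LinearMap.prodMap_apply, Submodule.subtype_apply, QuadraticMap.prod_apply]
  by_cases h0 : w = 0
  · have : 0 < Q' w' := hQ' w' fun h' => h (by simp [h0, h'])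
    positivity
  · have : 0 < Q w := hQ w h0
    positivity

lemma QuadraticForm.signature_prod [FiniteDimensional ℝ V] [FiniteDimensional ℝ V']
    (Q : QuadraticForm ℝ V) (Q' : QuadraticForm ℝ V') :
    signature (QuadraticMap.prod Q Q') = Q.signature + Q'.signature := by
  have hpos := sigPos_add_le_sigPos_prod Q Q'
  have hneg : sigNeg Q + sigNeg Q' ≤ sigNeg (QuadraticMap.prod Q Q') := by
    convert! sigPos_add_le_sigPos_prod (-Q) (-Q') using 1
    rw [← sigPos_neg]
    congr 1
    ext v
    simp [add_comm]
  have hrad : Module.finrank ℝ Q.radical + Module.finrank ℝ Q'.radical ≤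
      Module.finrank ℝ (QuadraticMap.prod Q Q').radical := by
    rw [← Module.finrank_prod]
    refine LinearMap.finrank_le_finrank_of_injective
      (f := (Q.radical.subtype.prodMap Q'.radical.subtype).codRestrict _ ?_) ?_
    · rintro ⟨⟨v, hv⟩, ⟨v', hv'⟩⟩
      rw [QuadraticMap.mem_radical_iff'] at hv hv' ⊢
      simp [hv.1, hv'.1, hv.2, hv'.2]
    · rw [← LinearMap.ker_eq_bot, LinearMap.ker_codRestrict, LinearMap.ker_eq_bot]
      exact Q.radical.injective_subtype.prodMap Q'.radical.injective_subtype
  have h := sigPos_add_sigNeg_add_radical (Q := Q)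
  have h' := sigPos_add_sigNeg_add_radical (Q := Q')
  have h'' := sigPos_add_sigNeg_add_radical (Q := QuadraticMap.prod Q Q')
  rw [Module.finrank_prod] at h''
  simp only [signature]
  lia

end Signature

section TripleForm

variable {ω : BilinForm ℝ E} {A B C X : Submodule ℝ E}

/-- The quadratic form `tripleQ ω A B C`, bundled. -/
noncomputable def tripleForm (ω : BilinForm ℝ E) (A B C : Submodule ℝ E) :
    QuadraticForm ℝ (A × B × C) :=
  LinearMap.BilinMap.toQuadraticMap <|
    ω.compl₁₂ (A.subtype ∘ₗ LinearMap.fst ℝ A (B × C))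
      (B.subtype ∘ₗ LinearMap.fst ℝ B C ∘ₗ LinearMap.snd ℝ A (B × C)) +
    ω.compl₁₂ (B.subtype ∘ₗ LinearMap.fst ℝ B C ∘ₗ LinearMap.snd ℝ A (B × C))
      (C.subtype ∘ₗ LinearMap.snd ℝ B C ∘ₗ LinearMap.snd ℝ A (B × C)) +
    ω.compl₁₂ (C.subtype ∘ₗ LinearMap.snd ℝ B C ∘ₗ LinearMap.snd ℝ A (B × C))
      (A.subtype ∘ₗ LinearMap.fst ℝ A (B × C))

@[simp]
lemma tripleForm_apply (v : A × B × C) :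
    tripleForm ω A B C v = ω v.1 v.2.1 + ω v.2.1 v.2.2 + ω v.2.2 v.1 := by
  simp [tripleForm]

lemma IsLagrangian.apply_eq_zero {L : Submodule ℝ E} (hL : IsLagrangian ω L) {x y : E}
    (hx : x ∈ L) (hy : y ∈ L) : ω x y = 0 := by
  rw [← hL, LinearMap.BilinForm.mem_orthogonal_iff] at hy
  exact hy x hx

lemma IsLagrangian.mem {L : Submodule ℝ E} (hL : IsLagrangian ω L) {y : E}
    (h : ∀ x ∈ L, ω x y = 0) : y ∈ L := by
  rw [← hL, LinearMap.BilinForm.mem_orthogonal_iff]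
  exact h

/-- The quadratic form `v ↦ ω (f v, g v)`. -/
noncomputable def pairForm {V : Type*} [AddCommGroup V] [Module ℝ V] (ω : BilinForm ℝ E)
    (f g : V →ₗ[ℝ] E) : QuadraticForm ℝ V :=
  LinearMap.BilinMap.toQuadraticMap (ω.compl₁₂ f g)

@[simp]
lemma pairForm_apply {V : Type*} [AddCommGroup V] [Module ℝ V] (f g : V →ₗ[ℝ] E) (v : V) :
    pairForm ω f g v = ω (f v) (g v) := by
  simp [pairForm]

/-- The parametrization of a complement `A` of `X` by the quotient `E ⧸ X`. -/
noncomputable def complSection (h : IsCompl X A) : (E ⧸ X) →ₗ[ℝ] E :=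
  A.subtype ∘ₗ (X.quotientEquivOfIsCompl A h).toLinearMap

lemma complSection_mem (h : IsCompl X A) (v : E ⧸ X) : complSection h v ∈ A := by
  simp [complSection]

lemma complSection_sub_mem (hA : IsCompl X A) (hB : IsCompl X B) (v : E ⧸ X) :
    complSection hA v - complSection hB v ∈ X := by
  rw [← Submodule.Quotient.eq]
  exact (X.mk_quotientEquivOfIsCompl_apply hA v).trans (X.mk_quotientEquivOfIsCompl_apply hB v).symm

lemma apply_complSection_comm (hω : ω.IsAlt) (hX : IsLagrangian ω X) (hA : IsLagrangian ω A)
    (hB : IsLagrangian ω B) (hXA : IsCompl X A) (hXB : IsCompl X B) (v w : E ⧸ X) :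
    ω (complSection hXA v) (complSection hXB w) = ω (complSection hXA w) (complSection hXB v) := by
  have h := hX.apply_eq_zero (complSection_sub_mem hXA hXB v) (complSection_sub_mem hXA hXB w)
  have h1 := hA.apply_eq_zero (complSection_mem hXA v) (complSection_mem hXA w)
  have h2 := hB.apply_eq_zero (complSection_mem hXB v) (complSection_mem hXB w)
  have h3 := hω.neg_eq (complSection hXA w) (complSection hXB v)
  simp only [map_sub, LinearMap.sub_apply] at h
  linarith

lemma apply_complSection_cyclic (hω : ω.IsAlt) (hX : IsLagrangian ω X) (hA : IsLagrangian ω A)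
    (hB : IsLagrangian ω B) (hC : IsLagrangian ω C) (hXA : IsCompl X A) (hXB : IsCompl X B)
    (hXC : IsCompl X C) (v w : E ⧸ X) :
    ω (complSection hXA v) (complSection hXB w) + ω (complSection hXB v) (complSection hXC w) +
      ω (complSection hXC v) (complSection hXA w) = 0 := by
  have h := hX.apply_eq_zero (complSection_sub_mem hXA hXB v) (complSection_sub_mem hXA hXC w)
  have h1 := hA.apply_eq_zero (complSection_mem hXA v) (complSection_mem hXA w)
  have h2 := apply_complSection_comm hω hX hA hB hXA hXB v w
  have h3 := apply_complSection_comm hω hX hA hC hXA hXC v w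
  have h4 := hω.neg_eq (complSection hXA w) (complSection hXB v)
  have h5 := hω.neg_eq (complSection hXA w) (complSection hXC v)
  simp only [map_sub, LinearMap.sub_apply] at h
  linarith

variable [FiniteDimensional ℝ E]

lemma posIndex_tripleQ : posIndex (tripleQ ω A B C) = sigPos (tripleForm ω A B C) :=
  posIndex_eq_sigPos (tripleForm ω A B C)

lemma posIndex_neg_tripleQ :
    posIndex (fun v => -tripleQ ω A B C v) = sigNeg (tripleForm ω A B C) :=
  posIndex_eq_sigPos (-tripleForm ω A B C)

lemma tripleSig_eq_signature : tripleSig ω A B C = (tripleForm ω A B C).signature := by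
  rw [tripleSig, posIndex_tripleQ, posIndex_neg_tripleQ, QuadraticForm.signature]

lemma tripleSig_rotate (ω : BilinForm ℝ E) (A B C : Submodule ℝ E) :
    tripleSig ω B C A = tripleSig ω A B C := by
  rw [tripleSig_eq_signature, tripleSig_eq_signature]
  refine QuadraticForm.signature_eq_of_equiv
    ((LinearEquiv.prodAssoc ℝ B C A).symm.trans (LinearEquiv.prodComm ℝ (B × C) A)) ?_
  rintro ⟨b, c, a⟩
  change tripleForm ω A B C (a, b, c) = tripleForm ω B C A (b, c, a)
  simp only [tripleForm_apply]
  ring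

lemma tripleSig_swap (hω : ω.IsAlt) (A B C : Submodule ℝ E) :
    tripleSig ω B A C = -tripleSig ω A B C := by
  rw [tripleSig_eq_signature, tripleSig_eq_signature, ← QuadraticForm.signature_neg]
  refine QuadraticForm.signature_eq_of_equiv
    ((LinearEquiv.prodAssoc ℝ B A C).symm.trans (((LinearEquiv.prodComm ℝ B A).prodCongr
      (LinearEquiv.refl ℝ C)).trans (LinearEquiv.prodAssoc ℝ A B C))) ?_
  rintro ⟨b, a, c⟩
  change (-tripleForm ω A B C) (a, b, c) = tripleForm ω B A C (b, a, c)
  simp [← hω.neg_eq (a : E) b, ← hω.neg_eq (b : E) c, ← hω.neg_eq (c : E) a]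
  ring

lemma tripleSig_self_right (hω : ω.IsAlt) (A B : Submodule ℝ E) : tripleSig ω A B B = 0 := by
  have h := tripleSig_swap hω B B A
  rw [← tripleSig_rotate ω A B B]
  lia

lemma tripleSig_self_outer (hω : ω.IsAlt) (A B : Submodule ℝ E) : tripleSig ω A B A = 0 := by
  rw [← tripleSig_rotate ω A B A, tripleSig_self_right hω]

lemma tripleSig_self_left (hω : ω.IsAlt) (A B : Submodule ℝ E) : tripleSig ω A A B = 0 := by
  rw [← tripleSig_rotate ω A A B, tripleSig_self_outer hω]

lemma IsLagrangian.two_mul_finrank (hnd : ω.Nondegenerate) {L : Submodule ℝ E}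
    (hL : IsLagrangian ω L) : 2 * Module.finrank ℝ L = Module.finrank ℝ E := by
  have h := LinearMap.BilinForm.finrank_orthogonal hnd L
  have := L.finrank_le
  rw [hL] at h
  lia

lemma IsLagrangian.isCompl (hnd : ω.Nondegenerate) (hX : IsLagrangian ω X) (hA : IsLagrangian ω A)
    (h : X ⊓ A = ⊥) : IsCompl X A := by
  have h1 := hX.two_mul_finrank hnd
  have h2 := hA.two_mul_finrank hnd
  have h3 := Submodule.finrank_sup_add_finrank_inf_eq X A
  rw [h, finrank_bot] at h3
  refine ⟨disjoint_iff.2 h, codisjoint_iff.2 (Submodule.eq_top_of_finrank_eq ?_)⟩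
  lia

/-- The signature of a triplet whose first two members are transverse to the third one. -/
lemma tripleSig_eq_signature_pairForm (hω : ω.IsAlt) (hX : IsLagrangian ω X)
    (hB : IsLagrangian ω B) (hXA : IsCompl X A) (hXB : IsCompl X B) :
    tripleSig ω A B X = (pairForm ω (complSection hXA) (complSection hXB)).signature := by
  let f := complSection hXA
  let g := complSection hXB
  let D : (E ⧸ X) →ₗ[ℝ] X := (g - f).codRestrict X fun v => complSection_sub_mem hXB hXA v
  let shear : ((E ⧸ X) × (E ⧸ X) × X) ≃ₗ[ℝ] ((E ⧸ X) × (E ⧸ X) × X) :=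
    { toFun p := (p.1, p.1 + p.2.1, p.2.2 - D p.1)
      invFun p := (p.1, p.2.1 - p.1, p.2.2 + D p.1)
      map_add' p q := by
        ext1
        · simp
        · ext1 <;> simp <;> abel
      map_smul' c p := by simp [smul_sub]
      left_inv p := by simp
      right_inv p := by simp }
  let hyp : QuadraticForm ℝ ((E ⧸ X) × X) :=
    pairForm ω (g ∘ₗ LinearMap.fst ℝ (E ⧸ X) X) (X.subtype ∘ₗ LinearMap.snd ℝ (E ⧸ X) X)
  have hhyp : hyp.signature = 0 := by
    have : hyp.signature = (-hyp).signature := QuadraticForm.signature_eq_of_equiv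
      ((LinearEquiv.neg ℝ).prodCongr (LinearEquiv.refl ℝ X)) fun v => by simp [hyp]
    rw [QuadraticForm.signature_neg] at this
    lia
  rw [← add_zero (QuadraticForm.signature _), ← hhyp, ← QuadraticForm.signature_prod,
    tripleSig_eq_signature]
  refine (QuadraticForm.signature_eq_of_equiv (shear.trans
    ((X.quotientEquivOfIsCompl A hXA).prodCongr
      ((X.quotientEquivOfIsCompl B hXB).prodCongr (LinearEquiv.refl ℝ X)))) ?_).symm
  rintro ⟨v, d, ξ⟩
  have hX1 := hX.apply_eq_zero (complSection_sub_mem hXB hXA v) ξ.2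
  have hgg := hB.apply_eq_zero (complSection_mem hXB d) (complSection_mem hXB v)
  have hfg := hω.neg_eq (f v) (g v)
  have hfgd := hω.neg_eq (f v) (g d)
  have hξ := hω.neg_eq (ξ : E) (f v)
  have hf := hω.self_eq_zero (f v)
  have hg := hω.self_eq_zero (g v)
  rw [tripleForm_apply]
  change ω (f v) (g (v + d)) + ω (g (v + d)) ((ξ : E) - (g v - f v)) +
    ω ((ξ : E) - (g v - f v)) (f v) = ω (f v) (g v) + ω (g d) ξ
  change ω (g v - f v) ξ = 0 at hX1
  change ω (g d) (g v) = 0 at hgg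
  simp only [map_sub, map_add, LinearMap.sub_apply, LinearMap.add_apply] at hX1 ⊢
  linarith

/-- The signature of a triplet of Lagrangian subspaces that are all transverse to `X`. -/
lemma tripleSig_eq_add_of_isCompl (hω : ω.IsAlt) (hX : IsLagrangian ω X) (hA : IsLagrangian ω A)
    (hB : IsLagrangian ω B) (hC : IsLagrangian ω C) (hXA : IsCompl X A) (hXB : IsCompl X B)
    (hXC : IsCompl X C) :
    tripleSig ω A B C = tripleSig ω A B X + tripleSig ω B C X + tripleSig ω C A X := by
  rw [tripleSig_eq_signature_pairForm hω hX hB hXA hXB,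
    tripleSig_eq_signature_pairForm hω hX hC hXB hXC,
    tripleSig_eq_signature_pairForm hω hX hA hXC hXA, tripleSig_eq_signature, add_assoc,
    ← QuadraticForm.signature_prod, ← QuadraticForm.signature_prod]
  symm
  let e : ((E ⧸ X) × (E ⧸ X) × (E ⧸ X)) ≃ₗ[ℝ] ((E ⧸ X) × (E ⧸ X) × (E ⧸ X)) :=
    { toFun p := (p.1 + p.2.2, p.1 + p.2.1, p.2.1 + p.2.2)
      invFun p := ((2⁻¹ : ℝ) • (p.1 + p.2.1 - p.2.2), (2⁻¹ : ℝ) • (p.2.1 + p.2.2 - p.1),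
        (2⁻¹ : ℝ) • (p.1 + p.2.2 - p.2.1))
      map_add' p q := by
        ext1
        · simp; abel
        · ext1 <;> simp <;> abel
      map_smul' c p := by simp
      left_inv p := by
        ext1
        · simp; module
        · ext1 <;> simp <;> module
      right_inv p := by
        ext1
        · simp; module
        · ext1 <;> simp <;> module }
  refine QuadraticForm.signature_eq_of_equiv (e.trans
    ((X.quotientEquivOfIsCompl A hXA).prodCongr
      ((X.quotientEquivOfIsCompl B hXB).prodCongr (X.quotientEquivOfIsCompl C hXC)))) ?_
  rintro ⟨u, v, w⟩
  have h1 := apply_complSection_cyclic hω hX hA hB hC hXA hXB hXC u v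
  have h2 := apply_complSection_cyclic hω hX hA hB hC hXA hXB hXC v w
  have h3 := apply_complSection_cyclic hω hX hA hB hC hXA hXB hXC u w
  have h4 := apply_complSection_comm hω hX hA hB hXA hXB
  have h5 := apply_complSection_comm hω hX hB hC hXB hXC
  have h6 := apply_complSection_comm hω hX hC hA hXC hXA
  rw [tripleForm_apply]
  change ω (complSection hXA (u + w)) (complSection hXB (u + v)) +
      ω (complSection hXB (u + v)) (complSection hXC (v + w)) +
      ω (complSection hXC (v + w)) (complSection hXA (u + w)) =
    ω (complSection hXA u) (complSection hXB u) + (ω (complSection hXB v) (complSection hXC v) +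
      ω (complSection hXC w) (complSection hXA w))
  simp only [map_add, LinearMap.add_apply]
  linarith [h4 u v, h4 v w, h4 u w, h5 u v, h5 v w, h5 u w, h6 u v, h6 v w, h6 u w]

end TripleForm

section Transversal

variable {ω : BilinForm ℝ E}

lemma finrank_radical_tripleForm (hω : ω.IsAlt) {A B C : Submodule ℝ E} (hA : IsLagrangian ω A)
    (hB : IsLagrangian ω B) (hC : IsLagrangian ω C) (hAB : A ⊓ B = ⊥) (hAC : A ⊓ C = ⊥) :
    Module.finrank ℝ (tripleForm ω A B C).radical = Module.finrank ℝ (B ⊓ C : Submodule ℝ E) := by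
  have hmem (v : A × B × C) : v ∈ (tripleForm ω A B C).radical ↔
      (v.1 : E) = 0 ∧ (v.2.1 : E) = v.2.2 := by
    rw [QuadraticMap.mem_radical_iff']
    obtain ⟨x, y, z⟩ := v
    constructor
    · rintro ⟨h0, h⟩
      have hyz : (y : E) - z ∈ A := hA.mem fun a ha => by
        have := h (⟨a, ha⟩, 0, 0)
        have h2 := hω.neg_eq (z : E) a
        simp at this h0 ⊢
        linarith
      have hzx : (z : E) - x ∈ B := hB.mem fun b hb => by
        have := h (0, ⟨b, hb⟩, 0)
        have h2 := hω.neg_eq (x : E) b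
        simp at this h0 ⊢
        linarith
      have hxy : (x : E) - y ∈ C := hC.mem fun c hc => by
        have := h (0, 0, ⟨c, hc⟩)
        have h2 := hω.neg_eq (y : E) c
        simp at this h0 ⊢
        linarith
      have h1 : (x : E) + y - z ∈ A ⊓ B := by
        refine ⟨?_, ?_⟩
        · rw [add_sub_assoc]; exact A.add_mem x.2 hyz
        · have := B.sub_mem y.2 hzx
          rwa [show (y : E) - (z - x) = x + y - z by abel] at this
      have h2 : (x : E) - y + z ∈ A ⊓ C := by
        refine ⟨?_, C.add_mem hxy z.2⟩
        have := A.sub_mem x.2 hyz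
        rwa [show (x : E) - (y - z) = x - y + z by abel] at this
      rw [hAB, Submodule.mem_bot] at h1
      rw [hAC, Submodule.mem_bot] at h2
      have hx : (x : E) = 0 := by
        have : (2 : ℝ) • (x : E) = ((x : E) + y - z) + (x - y + z) := by module
        simpa [h1, h2] using this
      refine ⟨hx, ?_⟩
      simpa [hx, sub_eq_zero] using h1
    · rintro ⟨hx, hyz⟩
      change (x : E) = 0 at hx
      change (y : E) = z at hyz
      simp only [hx, hyz, tripleForm_apply, map_zero, LinearMap.zero_apply]
      refine ⟨by simp [hω.self_eq_zero], fun n => ?_⟩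
      have h3 := hω.neg_eq (z : E) n.1
      have h4 := hω.self_eq_zero (z : E)
      have h5 := hC.apply_eq_zero z.2 n.2.2.2
      have h6 := hB.apply_eq_zero n.2.1.2 y.2
      simp only [hyz] at h6
      simp [hx, hyz, h4, h5, h6]
      linarith
  have hL (w : (B ⊓ C : Submodule ℝ E)) :
      ((0 : A), (⟨w, w.2.1⟩ : B), (⟨w, w.2.2⟩ : C)) ∈ (tripleForm ω A B C).radical := by
    simp [hmem]
  symm
  refine LinearEquiv.finrank_eq
    { toFun w := ⟨_, hL w⟩
      invFun v := ⟨v.1.2.1, v.1.2.1.2, by rw [((hmem v).1 v.2).2]; exact v.1.2.2.2⟩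
      map_add' w w' := by ext <;> simp
      map_smul' c w := by ext <;> simp
      left_inv w := by simp
      right_inv v := by
        obtain ⟨⟨x, y, z⟩, hv⟩ := v
        obtain ⟨hx, hyz⟩ := (hmem _).1 hv
        ext <;> simp_all }

variable [FiniteDimensional ℝ E]

lemma exists_isLagrangian_forall_inf_eq_bot (hω : ω.IsAlt) (hnd : ω.Nondegenerate)
    (S : Finset (Submodule ℝ E)) (hS : ∀ A ∈ S, IsLagrangian ω A) :
    ∃ X, IsLagrangian ω X ∧ ∀ A ∈ S, X ⊓ A = ⊥ := by
  obtain ⟨X, ⟨hXX, hXS⟩, hmax⟩ := WellFounded.has_min (wellFounded_gt (α := Submodule ℝ E))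
    {X | X ≤ ω.orthogonal X ∧ ∀ A ∈ S, X ⊓ A = ⊥} ⟨⊥, by simp⟩
  refine ⟨X, ?_, hXS⟩
  by_contra hX
  have hlt : X < ω.orthogonal X := lt_of_le_of_ne hXX (Ne.symm hX)
  let Y := ω.orthogonal X
  classical
  obtain ⟨e, he, heS⟩ : ∃ e ∈ Y, e ∉ X ∧ ∀ A ∈ S, e ∉ X ⊔ A := by
    have hcov := Subspace.biUnion_ne_univ_of_top_notMem (k := ℝ) (E := Y)
      (s := insert (X.comap Y.subtype) (S.image fun A => (X ⊔ A).comap Y.subtype)) <| by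
        simp only [Finset.mem_insert, Finset.mem_image, not_or, not_exists, not_and]
        refine ⟨fun h => hlt.not_ge (Submodule.comap_subtype_eq_top.1 h.symm), fun A hA h => ?_⟩
        have hle : Y ≤ X ⊔ A := Submodule.comap_subtype_eq_top.1 h
        have hYA : Y ⊓ A ≤ X := by
          intro x hx
          rw [← LinearMap.BilinForm.orthogonal_orthogonal hnd hω.isRefl X,
            LinearMap.BilinForm.mem_orthogonal_iff]
          intro y hy
          obtain ⟨z, hz, a, ha, rfl⟩ := Submodule.mem_sup.1 (hle hy)
          have h1 : ω z x = 0 := (LinearMap.BilinForm.mem_orthogonal_iff.1 hx.1) z hz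
          have h2 := (hS A hA).apply_eq_zero ha hx.2
          simp [h1, h2]
        refine hlt.not_ge fun y hy => ?_
        obtain ⟨z, hz, a, ha, rfl⟩ := Submodule.mem_sup.1 (hle hy)
        have haY : a ∈ Y := by simpa using Y.sub_mem hy (hlt.le hz)
        exact X.add_mem hz (hYA ⟨haY, ha⟩)
    obtain ⟨e, he⟩ := (Set.ne_univ_iff_exists_notMem _).1 hcov
    refine ⟨e, e.2, fun h => he ?_, fun A hA h => he ?_⟩
    · simp [h]
    · simp only [Set.mem_iUnion]
      exact ⟨_, Finset.mem_insert_of_mem (Finset.mem_image_of_mem _ hA), h⟩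
  refine hmax (X ⊔ ℝ ∙ e) ⟨?_, fun A hA => ?_⟩ ?_
  · intro x hx
    rw [LinearMap.BilinForm.mem_orthogonal_iff]
    intro y hy
    obtain ⟨x', hx', _, he1, rfl⟩ := Submodule.mem_sup.1 hx
    obtain ⟨c, rfl⟩ := Submodule.mem_span_singleton.1 he1
    obtain ⟨y', hy', _, he2, rfl⟩ := Submodule.mem_sup.1 hy
    obtain ⟨d, rfl⟩ := Submodule.mem_span_singleton.1 he2
    have h1 : ω y' x' = 0 := LinearMap.BilinForm.mem_orthogonal_iff.1 (hXX hx') y' hy'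
    have h2 : ω y' e = 0 := LinearMap.BilinForm.mem_orthogonal_iff.1 he y' hy'
    have h3 : ω x' e = 0 := LinearMap.BilinForm.mem_orthogonal_iff.1 he x' hx'
    have h4 : ω e x' = 0 := by rw [← hω.neg_eq, h3, neg_zero]
    simp [h1, h2, h4, hω.self_eq_zero e]
  · rw [Submodule.eq_bot_iff]
    rintro _ ⟨hx, hxA⟩
    obtain ⟨x, hxX, _, he1, rfl⟩ := Submodule.mem_sup.1 hx
    obtain ⟨c, rfl⟩ := Submodule.mem_span_singleton.1 he1
    have hc : c = 0 := by
      by_contra hc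
      refine heS.2 A hA ?_
      have : e = c⁻¹ • (x + c • e) - c⁻¹ • x := by
        rw [smul_add, inv_smul_smul₀ hc, add_sub_cancel_left]
      rw [this]
      exact Submodule.sub_mem _ (Submodule.smul_mem _ _ (Submodule.mem_sup_right hxA))
        (Submodule.smul_mem _ _ (Submodule.mem_sup_left hxX))
    subst hc
    rw [zero_smul, add_zero] at hxA ⊢
    have : x ∈ X ⊓ A := ⟨hxX, hxA⟩
    simpa [hXS A hA] using this
  · refine lt_of_le_of_ne le_sup_left fun h => heS.1 ?_
    rw [h]
    exact Submodule.mem_sup_right (Submodule.mem_span_singleton_self e)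

/-- The cocycle identity for the signature of triplets of Lagrangian subspaces. -/
lemma tripleSig_cocycle (hω : ω.IsAlt) (hnd : ω.Nondegenerate) {A B C D : Submodule ℝ E}
    (hA : IsLagrangian ω A) (hB : IsLagrangian ω B) (hC : IsLagrangian ω C)
    (hD : IsLagrangian ω D) :
    tripleSig ω A B C - tripleSig ω A B D + tripleSig ω A C D - tripleSig ω B C D = 0 := by
  classical
  obtain ⟨X, hX, hXS⟩ := exists_isLagrangian_forall_inf_eq_bot hω hnd {A, B, C, D} (by simp [*])
  have hXA := hX.isCompl hnd hA (hXS A (by simp))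
  have hXB := hX.isCompl hnd hB (hXS B (by simp))
  have hXC := hX.isCompl hnd hC (hXS C (by simp))
  have hXD := hX.isCompl hnd hD (hXS D (by simp))
  rw [tripleSig_eq_add_of_isCompl hω hX hA hB hC hXA hXB hXC,
    tripleSig_eq_add_of_isCompl hω hX hA hB hD hXA hXB hXD,
    tripleSig_eq_add_of_isCompl hω hX hA hC hD hXA hXC hXD,
    tripleSig_eq_add_of_isCompl hω hX hB hC hD hXB hXC hXD,
    tripleSig_swap hω A C X, tripleSig_swap hω B D X]
  ring

lemma sigPos_add_sigNeg_tripleForm (hω : ω.IsAlt) (hnd : ω.Nondegenerate) {A B C : Submodule ℝ E}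
    (hA : IsLagrangian ω A) (hB : IsLagrangian ω B) (hC : IsLagrangian ω C)
    (hAB : A ⊓ B = ⊥) (hAC : A ⊓ C = ⊥) :
    2 * (sigPos (tripleForm ω A B C) + sigNeg (tripleForm ω A B C) +
      Module.finrank ℝ (B ⊓ C : Submodule ℝ E)) = 3 * Module.finrank ℝ E := by
  have h := QuadraticForm.sigPos_add_sigNeg_add_radical (Q := tripleForm ω A B C)
  rw [finrank_radical_tripleForm hω hA hB hC hAB hAC, Module.finrank_prod,
    Module.finrank_prod] at h
  have h1 := hA.two_mul_finrank hnd
  have h2 := hB.two_mul_finrank hnd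
  have h3 := hC.two_mul_finrank hnd
  lia

end Transversal

section Topology

open Filter Topology QuadraticForm

/-- A family of functions which are homogeneous of degree two and positive on `W \ {0}` at one
parameter is positive on `W \ {0}` at all nearby parameters. -/
lemma eventually_forall_mem_pos {S V : Type*} [TopologicalSpace S] [NormedAddCommGroup V]
    [NormedSpace ℝ V] [FiniteDimensional ℝ V] (W : Submodule ℝ V) {f : S → V → ℝ}
    (hf : Continuous fun p : S × V => f p.1 p.2)
    (hsmul : ∀ s (c : ℝ) v, f s (c • v) = c ^ 2 * f s v)
    {s₀ : S} (h : ∀ v ∈ W, v ≠ 0 → 0 < f s₀ v) :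
    ∀ᶠ s in 𝓝 s₀, ∀ v ∈ W, v ≠ 0 → 0 < f s v := by
  have hK : IsCompact (Metric.sphere (0 : V) 1 ∩ W) :=
    (isCompact_sphere 0 1).inter_right W.closed_of_finiteDimensional
  have hev : ∀ᶠ s in 𝓝 s₀, ∀ v ∈ Metric.sphere (0 : V) 1 ∩ W, 0 < f s v := by
    refine hK.eventually_forall_of_forall_eventually fun v hv => ?_
    refine hf.continuousAt.eventually_const_lt (h v hv.2 ?_)
    exact ne_zero_of_mem_unit_sphere ⟨v, hv.1⟩
  filter_upwards [hev] with s hs v hv hv0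
  have hpos := hs (‖v‖⁻¹ • v) ⟨by simp [norm_smul, hv0], W.smul_mem _ hv⟩
  rw [hsmul] at hpos
  exact pos_of_mul_pos_right hpos (by positivity)

variable {ω : BilinForm ℝ E}

/-- A continuous family of Lagrangian subspaces parametrized by the set `K`. -/
structure IsLagrangianFamilyOn {T : Type*} [TopologicalSpace T] (ω : BilinForm ℝ E) (K : Set T)
    (H : T → Submodule ℝ E) : Prop where
  lag : ∀ p ∈ K, IsLagrangian ω (H p)
  exists_proj : ∀ p ∈ K, ∃ P : T → E →L[ℝ] E, ContinuousWithinAt P K p ∧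
    ∀ᶠ q in 𝓝[K] p, ∀ x, P q x ∈ H q ∧ (x ∈ H q → P q x = x)

lemma IsLagrangianHomotopy.isLagrangianFamilyOn {a b : ℝ} {L : ℝ → ℝ → Submodule ℝ E}
    (hL : IsLagrangianHomotopy ω a b L) :
    IsLagrangianFamilyOn ω (Set.Icc (0 : ℝ) 1 ×ˢ Set.Icc a b) fun p => L p.1 p.2 where
  lag p hp := hL.lag p.1 hp.1 p.2 hp.2
  exists_proj p hp := by
    obtain ⟨U, hU, hUK, P, hP, hPU⟩ := hL.locTriv p hp
    refine ⟨P, ((hP p (mem_of_mem_nhdsWithin hp hU)).mono_of_mem_nhdsWithin hU), ?_⟩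
    filter_upwards [hU] with q hq x
    obtain ⟨h1, h2⟩ := hPU q hq
    rw [← h2]
    refine ⟨⟨x, rfl⟩, ?_⟩
    rintro ⟨y, rfl⟩
    exact DFunLike.congr_fun h1 y

variable [FiniteDimensional ℝ E]

lemma eventually_forall_eq_zero_of_apply_eq (M : Submodule ℝ E) {P₀ : E →L[ℝ] E}
    (h : ∀ x ∈ M, P₀ x = x → x = 0) : ∀ᶠ P in 𝓝 P₀, ∀ x ∈ M, P x = x → x = 0 := by
  have hev := eventually_forall_mem_pos M (f := fun (P : E →L[ℝ] E) x => ‖P x - x‖ ^ 2) (s₀ := P₀)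
    (by fun_prop) (fun P c x => by rw [map_smul, ← smul_sub, norm_smul, mul_pow, Real.norm_eq_abs,
      sq_abs]) fun x hx hx0 => by
        have : P₀ x - x ≠ 0 := fun h0 => hx0 (h x hx (sub_eq_zero.1 h0))
        positivity
  filter_upwards [hev] with P hP x hx hPx
  by_contra hx0
  simpa [hPx] using hP x hx hx0

lemma eventually_sigPos_tripleForm_le (ω : BilinForm ℝ E) (A M N : Submodule ℝ E) {P₀ : E →L[ℝ] E}
    (hP₀ : ∀ x ∈ A, P₀ x = x) :
    ∀ᶠ P in 𝓝 P₀, ∀ B : Submodule ℝ E, (∀ x, P x ∈ B) →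
      sigPos (tripleForm ω A M N) ≤ sigPos (tripleForm ω B M N) := by
  obtain ⟨W, hW, hWpos⟩ := exists_finrank_eq_sigPos_and_posDef (tripleForm ω A M N)
  let β := ω.toContinuousBilinearMap
  have hev := eventually_forall_mem_pos W (f := fun (P : E →L[ℝ] E) (v : A × M × N) =>
    β (P v.1) v.2.1 + β v.2.1 v.2.2 + β v.2.2 (P v.1)) (s₀ := P₀) (by fun_prop)
    (fun P c v => by simp; ring) fun v hv hv0 => by
      have := hWpos ⟨v, hv⟩ (by simpa using hv0)
      simpa [β, hP₀ v.1 v.1.2] using this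
  filter_upwards [hev] with P hP B hB
  rw [← hW]
  refine finrank_le_sigPos_of_linearMap
    (((((P : E →ₗ[ℝ] E).comp A.subtype).codRestrict B fun x => hB x).prodMap LinearMap.id).comp
      W.subtype) fun v hv => ?_
  rw [tripleForm_apply]
  exact hP v v.2 (by simpa using hv)

namespace IsLagrangianFamilyOn

variable {T : Type*} [TopologicalSpace T] {K C : Set T} {H : T → Submodule ℝ E}

lemma eventually_inf_eq_bot (hH : IsLagrangianFamilyOn ω K H) {p : T} (hp : p ∈ K)
    {M : Submodule ℝ E} (hM : M ⊓ H p = ⊥) : ∀ᶠ q in 𝓝[K] p, M ⊓ H q = ⊥ := by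
  obtain ⟨P, hP, hPH⟩ := hH.exists_proj p hp
  have hPp := hPH.self_of_nhdsWithin hp
  have hev := hP.eventually (eventually_forall_eq_zero_of_apply_eq M fun x hx hPx => by
    have : x ∈ M ⊓ H p := ⟨hx, hPx ▸ (hPp x).1⟩
    simpa [hM] using this)
  filter_upwards [hev, hPH] with q hq hPq
  exact (Submodule.eq_bot_iff _).2 fun x hx => hq x hx.1 ((hPq x).2 hx.2)

lemma eventually_sigPos_le (hH : IsLagrangianFamilyOn ω K H) (β : BilinForm ℝ E) {p : T}
    (hp : p ∈ K) (M N : Submodule ℝ E) :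
    ∀ᶠ q in 𝓝[K] p, sigPos (tripleForm β (H p) M N) ≤ sigPos (tripleForm β (H q) M N) := by
  obtain ⟨P, hP, hPH⟩ := hH.exists_proj p hp
  have hPp := hPH.self_of_nhdsWithin hp
  have hev := hP.eventually (eventually_sigPos_tripleForm_le β (H p) M N fun x hx => (hPp x).2 hx)
  filter_upwards [hev, hPH] with q hq hPq
  exact hq _ fun x => (hPq x).1

lemma eventually_sigNeg_le (hH : IsLagrangianFamilyOn ω K H) {p : T} (hp : p ∈ K)
    (M N : Submodule ℝ E) :
    ∀ᶠ q in 𝓝[K] p, sigNeg (tripleForm ω (H p) M N) ≤ sigNeg (tripleForm ω (H q) M N) := by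
  have hneg (A : Submodule ℝ E) : tripleForm (-ω) A M N = -tripleForm ω A M N := by
    ext v
    simp
    ring
  have h := hH.eventually_sigPos_le (-ω) hp M N
  simp only [hneg] at h
  exact h

/-- The signature `s(H p, M, N)` is constant as long as `H p` stays transverse to `M` and `N`. -/
lemma tripleSig_eq_of_isPreconnected (hH : IsLagrangianFamilyOn ω K H) (hω : ω.IsAlt)
    (hnd : ω.Nondegenerate) (hCK : C ⊆ K) (hC : IsPreconnected C) {M N : Submodule ℝ E}
    (hM : IsLagrangian ω M) (hN : IsLagrangian ω N) (hMC : ∀ p ∈ C, M ⊓ H p = ⊥)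
    (hNC : ∀ p ∈ C, N ⊓ H p = ⊥) {p q : T} (hp : p ∈ C) (hq : q ∈ C) :
    tripleSig ω (H p) M N = tripleSig ω (H q) M N := by
  refine hC.constant (f := fun p => tripleSig ω (H p) M N) (fun p hp => ?_) hp hq
  refine tendsto_nhds_of_eventually_eq ?_
  have hsum (r : T) (hr : r ∈ C) := sigPos_add_sigNeg_tripleForm hω hnd (hH.lag r (hCK hr)) hM hN
    (by rw [inf_comm, hMC r hr]) (by rw [inf_comm, hNC r hr])
  filter_upwards [nhdsWithin_mono p hCK (hH.eventually_sigPos_le ω (hCK hp) M N),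
    nhdsWithin_mono p hCK (hH.eventually_sigNeg_le (hCK hp) M N), self_mem_nhdsWithin]
    with r hpos hneg hr
  have h1 := hsum p hp
  have h2 := hsum r hr
  simp only [tripleSig_eq_signature, signature]
  lia

/-- The increment of `s(H p, M, X)` does not depend on the choice of the transverse `M`. -/
lemma tripleSig_sub_eq_of_isPreconnected (hH : IsLagrangianFamilyOn ω K H) (hω : ω.IsAlt)
    (hnd : ω.Nondegenerate) (hCK : C ⊆ K) (hC : IsPreconnected C) {M N X : Submodule ℝ E}
    (hM : IsLagrangian ω M) (hN : IsLagrangian ω N) (hX : IsLagrangian ω X)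
    (hMC : ∀ p ∈ C, M ⊓ H p = ⊥) (hNC : ∀ p ∈ C, N ⊓ H p = ⊥) {p q : T} (hp : p ∈ C) (hq : q ∈ C) :
    tripleSig ω (H q) M X - tripleSig ω (H p) M X =
      tripleSig ω (H q) N X - tripleSig ω (H p) N X := by
  have h := hH.tripleSig_eq_of_isPreconnected hω hnd hCK hC hM hN hMC hNC hp hq
  have h1 := tripleSig_cocycle hω hnd (hH.lag p (hCK hp)) hM hN hX
  have h2 := tripleSig_cocycle hω hnd (hH.lag q (hCK hq)) hM hN hX
  lia

end IsLagrangianFamilyOn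

end Topology

section Primitive

open Topology

lemma sum_range_clamp_sub {G : ℝ → ℤ} {τ : ℕ → ℝ} (hτ : Monotone τ) (t : ℝ) (k : ℕ) :
    ∑ m ∈ Finset.range k, (G (max (τ m) (min t (τ (m + 1)))) - G (τ m)) =
      G (max (τ 0) (min t (τ k))) - G (τ 0) := by
  induction k with
  | zero => simp
  | succ k ih =>
    rw [Finset.sum_range_succ, ih]
    have h0 := hτ k.zero_le
    have h1 := hτ k.le_succ
    rcases le_total t (τ k) with h | h
    · rw [min_eq_left (h.trans h1), min_eq_left h, max_eq_left h]
      ring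
    · rw [min_eq_right h, max_eq_right h0, max_eq_right (le_min h h1),
        max_eq_right (h0.trans (le_min h h1))]
      ring

lemma exists_monotone_Icc_prod_Icc_subset {ι : Type*} {a b : ℝ} (hab : a < b)
    {R : ι → Set (ℝ × ℝ)}
    (hR : ∀ i, ∀ p ∈ Set.Icc (0 : ℝ) 1 ×ˢ Set.Icc a b, p ∈ R i →
      R i ∈ 𝓝[Set.Icc (0 : ℝ) 1 ×ˢ Set.Icc a b] p)
    (hcover : ∀ p ∈ Set.Icc (0 : ℝ) 1 ×ˢ Set.Icc a b, ∃ i, p ∈ R i) :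
    ∃ (σ τ : ℕ → ℝ) (k : ℕ), Monotone σ ∧ Monotone τ ∧ σ 0 = 0 ∧ τ 0 = a ∧
      (∀ n, k ≤ n → σ n = 1) ∧ (∀ n, k ≤ n → τ n = b) ∧
      ∀ n m, ∃ i, Set.Icc (σ n) (σ (n + 1)) ×ˢ Set.Icc (τ m) (τ (m + 1)) ⊆ R i := by
  let f : unitInterval × unitInterval → ℝ × ℝ := fun p => (p.1, a + (b - a) * p.2)
  have hba : 0 < b - a := sub_pos.2 hab
  have hf : Continuous f := by fun_prop
  have hfK (p) : f p ∈ Set.Icc (0 : ℝ) 1 ×ˢ Set.Icc a b := by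
    have h1 := p.2.2.1
    have h2 := p.2.2.2
    exact ⟨p.1.2, by simp only [f]; nlinarith, by simp only [f]; nlinarith⟩
  obtain ⟨σ, h0, hmono, ⟨k, hk⟩, hsub⟩ :=
    exists_monotone_Icc_subset_open_cover_unitInterval_prod_self (c := fun i => f ⁻¹' R i)
      (fun i => isOpen_iff_mem_nhds.2 fun p hp =>
        tendsto_nhdsWithin_iff.2 ⟨hf.continuousAt, .of_forall hfK⟩ (hR i _ (hfK p) hp))
      fun p _ => Set.mem_iUnion.2 (hcover _ (hfK p))
  refine ⟨fun n => σ n, fun n => a + (b - a) * σ n, k, fun m n h => hmono h, fun m n h => ?_,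
    by simp [h0], by simp [h0], fun n hn => by simp [hk n hn], fun n hn => by simp [hk n hn],
    fun n m => (hsub n m).imp fun i hi => ?_⟩
  · have : (σ m : ℝ) ≤ σ n := hmono h
    simp only
    gcongr
  · rintro ⟨x, y⟩ ⟨⟨hx1, hx2⟩, hy1, hy2⟩
    simp only at hx1 hx2 hy1 hy2
    have hy : a + (b - a) * ((y - a) / (b - a)) = y := by field_simp; ring
    have hy1' : (σ m : ℝ) ≤ (y - a) / (b - a) := by rw [le_div_iff₀ hba]; linarith
    have hy2' : (y - a) / (b - a) ≤ σ (m + 1) := by rw [div_le_iff₀ hba]; linarith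
    have := @hi (⟨x, (σ n).2.1.trans hx1, hx2.trans (σ (n + 1)).2.2⟩,
      ⟨(y - a) / (b - a), (σ m).2.1.trans hy1', hy2'.trans (σ (m + 1)).2.2⟩)
      ⟨⟨hx1, hx2⟩, hy1', hy2'⟩
    simpa only [Set.mem_preimage, f, hy] using this

/-- Local potentials on a rectangle whose differences are locally constant, and which are constant
along three sides of the rectangle, have a common primitive with trivial total increment along the
fourth side. -/
lemma exists_primitive {ι : Type*} {a b : ℝ} (hab : a < b) {φ : ι → ℝ × ℝ → ℤ}
    {R : ι → Set (ℝ × ℝ)}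
    (hR : ∀ i, ∀ p ∈ Set.Icc (0 : ℝ) 1 ×ˢ Set.Icc a b, p ∈ R i →
      R i ∈ 𝓝[Set.Icc (0 : ℝ) 1 ×ˢ Set.Icc a b] p)
    (hcover : ∀ p ∈ Set.Icc (0 : ℝ) 1 ×ˢ Set.Icc a b, ∃ i, p ∈ R i)
    (hφ : ∀ i j s s' t t', Set.Icc s s' ×ˢ Set.Icc t t' ⊆ Set.Icc (0 : ℝ) 1 ×ˢ Set.Icc a b →
      Set.Icc s s' ×ˢ Set.Icc t t' ⊆ R i → Set.Icc s s' ×ˢ Set.Icc t t' ⊆ R j →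
      ∀ p ∈ Set.Icc s s' ×ˢ Set.Icc t t', ∀ q ∈ Set.Icc s s' ×ˢ Set.Icc t t',
        φ i q - φ i p = φ j q - φ j p)
    (ha : ∀ i, ∀ s ∈ Set.Icc (0 : ℝ) 1, φ i (s, a) = φ i (0, a))
    (hb : ∀ i, ∀ s ∈ Set.Icc (0 : ℝ) 1, φ i (s, b) = φ i (0, b))
    (h1 : ∀ i, ∀ t ∈ Set.Icc a b, φ i (1, t) = φ i (1, a)) :
    ∃ F : ℝ → ℤ, F a = F b ∧ ∀ i u v, a ≤ u → u ≤ v → v ≤ b →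
      (∀ t ∈ Set.Icc u v, ((0 : ℝ), t) ∈ R i) → F v - F u = φ i (0, v) - φ i (0, u) := by
  obtain ⟨σ, τ, k, hσ, hτ, hσ0, hτ0, hσk, hτk, hsub⟩ :=
    exists_monotone_Icc_prod_Icc_subset hab hR hcover
  choose M hM using hsub
  have hσI (n) : σ n ∈ Set.Icc (0 : ℝ) 1 :=
    ⟨hσ0 ▸ hσ n.zero_le, hσk _ (le_max_right n k) ▸ hσ (le_max_left n k)⟩
  have hτI (n) : τ n ∈ Set.Icc a b :=
    ⟨hτ0 ▸ hτ n.zero_le, hτk _ (le_max_right n k) ▸ hτ (le_max_left n k)⟩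
  have hsubK {s s' t t' : ℝ} (hs : s ∈ Set.Icc (0 : ℝ) 1) (hs' : s' ∈ Set.Icc (0 : ℝ) 1)
      (ht : t ∈ Set.Icc a b) (ht' : t' ∈ Set.Icc a b) :
      Set.Icc s s' ×ˢ Set.Icc t t' ⊆ Set.Icc (0 : ℝ) 1 ×ˢ Set.Icc a b :=
    Set.prod_mono (Set.Icc_subset_Icc hs.1 hs'.2) (Set.Icc_subset_Icc ht.1 ht'.2)
  let J (n : ℕ) (s : ℝ) : ℤ :=
    ∑ m ∈ Finset.range k, (φ (M n m) (s, τ (m + 1)) - φ (M n m) (s, τ m))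
  have hJ_const (n : ℕ) : J n (σ (n + 1)) = J n (σ n) := by
    let V (m : ℕ) : ℤ := φ (M n m) (σ (n + 1), τ m) - φ (M n m) (σ n, τ m)
    have hV (m : ℕ) : V (m + 1) =
        φ (M n m) (σ (n + 1), τ (m + 1)) - φ (M n m) (σ n, τ (m + 1)) := by
      refine hφ _ _ (σ n) (σ (n + 1)) (τ (m + 1)) (τ (m + 1))
        (hsubK (hσI _) (hσI _) (hτI _) (hτI _))
        ((Set.prod_mono subset_rfl (Set.Icc_subset_Icc le_rfl (hτ (m + 1).le_succ))).trans
          (hM n (m + 1)))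
        ((Set.prod_mono subset_rfl (Set.Icc_subset_Icc (hτ m.le_succ) le_rfl)).trans (hM n m))
        _ ?_ _ ?_ <;> simp [hσ n.le_succ]
    have hV0 : V 0 = 0 := by
      simp only [V, hτ0]
      rw [ha _ _ (hσI _), ha _ _ (hσI n), sub_self]
    have hVk : V k = 0 := by
      simp only [V, hτk k le_rfl]
      rw [hb _ _ (hσI _), hb _ _ (hσI n), sub_self]
    rw [← sub_eq_zero, ← Finset.sum_sub_distrib, ← sub_eq_zero.2 (hVk.trans hV0.symm),
      ← Finset.sum_range_sub V]
    refine Finset.sum_congr rfl fun m _ => ?_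
    rw [hV]
    ring
  have hJ_succ (n : ℕ) : J n (σ (n + 1)) = J (n + 1) (σ (n + 1)) := by
    refine Finset.sum_congr rfl fun m _ => hφ _ _ (σ (n + 1)) (σ (n + 1)) (τ m) (τ (m + 1))
        (hsubK (hσI _) (hσI _) (hτI _) (hτI _))
        ((Set.prod_mono (Set.Icc_subset_Icc (hσ n.le_succ) le_rfl) subset_rfl).trans (hM n m))
        ((Set.prod_mono (Set.Icc_subset_Icc le_rfl (hσ (n + 1).le_succ)) subset_rfl).trans
          (hM (n + 1) m)) _ ?_ _ ?_ <;> simp [hτ m.le_succ]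
  have hJ (n : ℕ) : J n (σ n) = J 0 0 := by
    induction n with
    | zero => rw [hσ0]
    | succ n ih => rw [← hJ_succ, hJ_const, ih]
  have hJ0 : J 0 0 = 0 := by
    rw [← hJ k, hσk k le_rfl]
    refine Finset.sum_eq_zero fun m _ => ?_
    rw [h1 _ _ (hτI _), h1 _ _ (hτI m), sub_self]
  let c (m : ℕ) (t : ℝ) : ℝ := max (τ m) (min t (τ (m + 1)))
  have hcI (m : ℕ) (t : ℝ) : c m t ∈ Set.Icc (τ m) (τ (m + 1)) :=
    ⟨le_max_left _ _, max_le (hτ m.le_succ) (min_le_right _ _)⟩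
  refine ⟨fun t => ∑ m ∈ Finset.range k, φ (M 0 m) (0, c m t), ?_, fun i u v hu huv hv hi => ?_⟩
  · rw [eq_comm, ← sub_eq_zero, ← Finset.sum_sub_distrib, ← hJ0]
    refine Finset.sum_congr rfl fun m _ => ?_
    simp only [c]
    rw [min_eq_right (hτI _).2, max_eq_right (hτ m.le_succ), min_eq_left (hτI _).1,
      max_eq_left (hτI _).1]
  · have hterm (m : ℕ) : φ (M 0 m) (0, c m v) - φ (M 0 m) (0, c m u) =
        φ i (0, c m v) - φ i (0, c m u) := by
      rcases eq_or_ne (c m u) (c m v) with h | h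
      · simp [h]
      have hle : c m u ≤ c m v := max_le_max le_rfl (min_le_min huv le_rfl)
      have hlt := lt_of_le_of_ne hle h
      have hu' : u ≤ c m u := by
        by_contra! hlt'
        have : τ (m + 1) ≤ u := by
          by_contra! h2
          exact hlt'.not_ge ((min_eq_left h2.le).ge.trans (le_max_right _ _))
        exact hlt.not_ge ((hcI m v).2.trans ((min_eq_right this).ge.trans (le_max_right _ _)))
      have hv' : c m v ≤ v := by
        by_contra! hlt'
        have h2 : v < τ m := by
          by_contra! h2
          exact hlt'.not_ge (max_le h2 (min_le_left _ _))
        exact hlt.not_ge ((max_eq_left ((min_le_left _ _).trans h2.le)).le.trans (hcI m u).1)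
      refine hφ _ _ 0 0 (c m u) (c m v)
        (hsubK (by simp) (by simp) ⟨hu.trans hu', ?_⟩ ⟨?_, hv'.trans hv⟩)
        (Set.Subset.trans (Set.prod_mono (Set.Icc_subset_Icc hσ0.le (hσI _).1)
          (Set.Icc_subset_Icc (hcI m u).1 (hcI m v).2)) (hM 0 m)) ?_ _ ?_ _ ?_
      · exact hle.trans (hv'.trans hv)
      · exact hu.trans (hu'.trans hle)
      · rintro ⟨x, t⟩ ⟨hx, ht⟩
        obtain rfl : x = 0 := by simpa using hx
        exact hi t ⟨hu'.trans ht.1, ht.2.trans hv'⟩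
      · simp [hle]
      · simp [hle]
    have hsum (t : ℝ) (ht : a ≤ t) (ht' : t ≤ b) :
        ∑ m ∈ Finset.range k, (φ i (0, c m t) - φ i (0, τ m)) = φ i (0, t) - φ i (0, a) := by
      have := sum_range_clamp_sub (G := fun t => φ i (0, t)) hτ t k
      rwa [hτ0, hτk k le_rfl, min_eq_left ht', max_eq_right ht] at this
    have h2 := hsum u hu (huv.trans hv)
    have h3 := hsum v (hu.trans huv) hv
    simp only [← Finset.sum_sub_distrib, hterm]
    rw [Finset.sum_sub_distrib] at h2 h3 ⊢
    linarith

end Primitive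

section Leray

open Topology

variable {ω : BilinForm ℝ E}

lemma AdmissibleData.t_le {a b : ℝ} {L1 L2 : ℝ → Submodule ℝ E} (D : AdmissibleData ω a b L1 L2)
    {m n : ℕ} (hmn : m ≤ n) (hn : n ≤ D.k) : D.t m ≤ D.t n := by
  induction n, hmn using Nat.le_induction with
  | base => rfl
  | succ n _ ih => exact (ih (by lia)).trans (D.hmono n (by lia))

variable [FiniteDimensional ℝ E]

lemma IsLagrangianHomotopy.exists_primitive (hω : ω.IsAlt) (hnd : ω.Nondegenerate) {a b : ℝ}
    (hab : a < b) {H : ℝ → ℝ → Submodule ℝ E} (hH : IsLagrangianHomotopy ω a b H)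
    {L X : Submodule ℝ E} (hX : IsLagrangian ω X) (ha : ∀ s ∈ Set.Icc (0 : ℝ) 1, H s a = L)
    (hb : ∀ s ∈ Set.Icc (0 : ℝ) 1, H s b = L) (h1 : ∀ t ∈ Set.Icc a b, H 1 t = L) :
    ∃ F : ℝ → ℤ, F a = F b ∧ ∀ M, IsLagrangian ω M → ∀ u v, a ≤ u → u ≤ v → v ≤ b →
      (∀ t ∈ Set.Icc u v, M ⊓ H 0 t = ⊥) →
        F v - F u = tripleSig ω (H 0 v) M X - tripleSig ω (H 0 u) M X := by
  have hfam := hH.isLagrangianFamilyOn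
  obtain ⟨F, hF, hF'⟩ := _root_.exists_primitive (ι := {M // IsLagrangian ω M}) hab
    (φ := fun M p => tripleSig ω (H p.1 p.2) M X)
    (R := fun M => {p | (M : Submodule ℝ E) ⊓ H p.1 p.2 = ⊥})
    (fun M p hp hMp => hfam.eventually_inf_eq_bot hp hMp)
    (fun p hp => by
      obtain ⟨M, hM, hMp⟩ := exists_isLagrangian_forall_inf_eq_bot hω hnd {H p.1 p.2}
        (by simpa using hfam.lag p hp)
      exact ⟨⟨M, hM⟩, hMp (H p.1 p.2) (by simp)⟩)
    (fun M N s s' t t' hK hM hN p hp q hq => hfam.tripleSig_sub_eq_of_isPreconnected hω hnd hK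
      (isPreconnected_Icc.prod isPreconnected_Icc) M.2 N.2 hX hM hN hp hq)
    (fun M s hs => by simp [ha s hs, ha 0]) (fun M s hs => by simp [hb s hs, hb 0])
    (fun M t ht => by simp [h1 t ht, h1 a ⟨le_rfl, hab.le⟩])
  exact ⟨F, hF, fun M hM => hF' ⟨M, hM⟩⟩

/-- The intersection number with a constant path, in terms of a function `F` whose increments are
those of `s(γ t, M, X)`, for `M` transverse to `γ`. -/
lemma dataSum_const_eq (hω : ω.IsAlt) (hnd : ω.Nondegenerate) {a b : ℝ} {γ : ℝ → Submodule ℝ E}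
    {N X : Submodule ℝ E} (hγ : IsLagrangianPath ω a b γ) (hN : IsLagrangian ω N)
    (hX : IsLagrangian ω X) {F : ℝ → ℤ}
    (hF : ∀ M, IsLagrangian ω M → ∀ u v, a ≤ u → u ≤ v → v ≤ b →
      (∀ t ∈ Set.Icc u v, M ⊓ γ t = ⊥) →
        F v - F u = tripleSig ω (γ v) M X - tripleSig ω (γ u) M X)
    (D : AdmissibleData ω a b γ fun _ => N) :
    dataSum D = (1 / 2 : ℝ) *
      ((tripleSig ω (γ a) N X - F a - (tripleSig ω (γ b) N X - F b) : ℤ) : ℝ) := by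
  let g (ν : ℕ) : ℤ := tripleSig ω (γ (D.t ν)) N X - F (D.t ν)
  have hD (ν : ℕ) (hν : ν ≤ D.k) : D.t ν ∈ Set.Icc a b :=
    ⟨D.ht0.ge.trans (D.t_le ν.zero_le hν), (D.t_le hν le_rfl).trans D.htk.le⟩
  have hterm (ν : ℕ) (hν : ν < D.k) : tripleSig ω (γ (D.t ν)) N (D.M (ν + 1)) -
      tripleSig ω (γ (D.t (ν + 1))) N (D.M (ν + 1)) = g ν - g (ν + 1) := by
    have h := hF _ (D.hlag ν hν) _ _ (hD ν hν.le).1 (D.hmono ν hν) (hD (ν + 1) hν).2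
      (D.htrans1 ν hν)
    have h1 := tripleSig_cocycle hω hnd (hγ.lag _ (hD ν hν.le)) hN (D.hlag ν hν) hX
    have h2 := tripleSig_cocycle hω hnd (hγ.lag _ (hD (ν + 1) hν)) hN (D.hlag ν hν) hX
    simp only [g]
    lia
  have hsum := Finset.sum_congr rfl fun ν hν => hterm ν (Finset.mem_range.1 hν)
  rw [Finset.sum_range_sub'] at hsum
  simp only [g, D.ht0, D.htk] at hsum
  rw [dataSum, ← hsum]
  push_cast
  rfl

end Leray

/-- Leray's formula: let `γ12, γ23, γ31` be continuous paths of Lagrangian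
subspaces on `[0,1]` from `L1` to `L2`, from `L2` to `L3`, and from `L3` to `L1` respectively.
If the concatenated loop (realized on `[0,3]`) based at `L1` is null-homotopic through loops of
Lagrangian subspaces with fixed base point, then
`[γ12 : const_{L2}] + [γ23 : const_{L3}] + [γ31 : const_{L1}] = (1/2) s(L1,L2,L3)`,
each intersection number being computed from arbitrary admissible data. -/
theorem leray_formula [FiniteDimensional ℝ E]
    (ω : BilinForm ℝ E) (halt : LinearMap.IsAlt ω)
    (hnd : LinearMap.BilinForm.Nondegenerate ω)
    (L1 L2 L3 : Submodule ℝ E)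
    (h1 : IsLagrangian ω L1) (h2 : IsLagrangian ω L2) (h3 : IsLagrangian ω L3)
    (γ12 γ23 γ31 : ℝ → Submodule ℝ E)
    (hγ12 : IsLagrangianPath ω 0 1 γ12) (hγ23 : IsLagrangianPath ω 0 1 γ23)
    (hγ31 : IsLagrangianPath ω 0 1 γ31)
    (h120 : γ12 0 = L1) (h121 : γ12 1 = L2)
    (h230 : γ23 0 = L2) (h231 : γ23 1 = L3)
    (h310 : γ31 0 = L3) (h311 : γ31 1 = L1)
    -- the concatenated loop, realized on the interval `[0,3]`
    (γ : ℝ → Submodule ℝ E)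
    (hγ : γ = fun t => if t ≤ 1 then γ12 t else if t ≤ 2 then γ23 (t - 1) else γ31 (t - 2))
    -- null-homotopy of the concatenated loop with fixed base point
    (hnull : ∃ H : ℝ → ℝ → Submodule ℝ E, IsLagrangianHomotopy ω 0 3 H ∧
      H 0 = γ ∧ (∀ t ∈ Set.Icc (0:ℝ) 3, H 1 t = L1) ∧
      (∀ s ∈ Set.Icc (0:ℝ) 1, H s 0 = L1 ∧ H s 3 = L1))
    (D12 : AdmissibleData ω 0 1 γ12 (fun _ => L2))
    (D23 : AdmissibleData ω 0 1 γ23 (fun _ => L3))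
    (D31 : AdmissibleData ω 0 1 γ31 (fun _ => L1)) :
    dataSum D12 + dataSum D23 + dataSum D31 =
      (1 / 2 : ℝ) * (tripleSig ω L1 L2 L3 : ℝ) := by
  obtain ⟨H, hH, hH0, hH1, hHL⟩ := hnull
  obtain ⟨F, hF, hF'⟩ := hH.exists_primitive halt hnd (by norm_num) h1 (fun s hs => (hHL s hs).1)
    (fun s hs => (hHL s hs).2) hH1
  have e12 (t : ℝ) (ht : t ∈ Set.Icc (0 : ℝ) 1) : H 0 t = γ12 t := by
    simp [hH0, hγ, ht.2]
  have e23 (t : ℝ) (ht : t ∈ Set.Icc (0 : ℝ) 1) : H 0 (t + 1) = γ23 t := by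
    rcases ht.1.eq_or_lt with rfl | h
    · simp [hH0, hγ, h121, h230]
    · simp [hH0, hγ, h.not_ge, show t + 1 ≤ 2 by linarith [ht.2]]
  have e31 (t : ℝ) (ht : t ∈ Set.Icc (0 : ℝ) 1) : H 0 (t + 2) = γ31 t := by
    have h1t : ¬ t + 2 ≤ 1 := by linarith [ht.1]
    rcases ht.1.eq_or_lt with rfl | h
    · norm_num [hH0, hγ, h231, h310]
    · simp [hH0, hγ, h1t, h.not_ge]
  have hshift {η : ℝ → Submodule ℝ E} (c : ℝ) (hc : 0 ≤ c) (hc' : c + 1 ≤ 3)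
      (hη : ∀ t ∈ Set.Icc (0 : ℝ) 1, H 0 (t + c) = η t) (M : Submodule ℝ E)
      (hM : IsLagrangian ω M) (u v : ℝ) (hu : 0 ≤ u) (huv : u ≤ v) (hv : v ≤ 1)
      (hMη : ∀ t ∈ Set.Icc u v, M ⊓ η t = ⊥) :
      F (v + c) - F (u + c) = tripleSig ω (η v) M L1 - tripleSig ω (η u) M L1 := by
    rw [← hη u ⟨hu, huv.trans hv⟩, ← hη v ⟨hu.trans huv, hv⟩]
    refine hF' M hM _ _ (by linarith) (by linarith) (by linarith) fun t ht => ?_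
    have := hMη (t - c) ⟨by linarith [ht.1], by linarith [ht.2]⟩
    rwa [← hη _ ⟨by linarith [ht.1], by linarith [ht.2]⟩, sub_add_cancel] at this
  rw [dataSum_const_eq halt hnd hγ12 h2 h1 (F := fun t => F (t + 0))
      (hshift 0 le_rfl (by norm_num) (by simpa using e12)) D12,
    dataSum_const_eq halt hnd hγ23 h3 h1 (F := fun t => F (t + 1))
      (hshift 1 (by norm_num) (by norm_num) e23) D23,
    dataSum_const_eq halt hnd hγ31 h1 h1 (F := fun t => F (t + 2))
      (hshift 2 (by norm_num) (by norm_num) e31) D31,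
    h120, h121, h230, h231, h310, h311, tripleSig_self_left halt L2, tripleSig_self_left halt L3,
    tripleSig_self_left halt L1, tripleSig_self_outer halt, tripleSig_self_right halt,
    tripleSig_rotate ω L1 L2 L3]
  norm_num [← hF]
  ring
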